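/- Let 0 < s < 1 and δ > 0. There exists a finite constant C = C(s,δ) such that for all t ≥ 0: e^{−t} · ( ∫_ℝ |ξ|^{2s} ( exp( t/(1 + ξ²/(1+t)) ) − 1 )² dξ )^{1/2} ≤ C (1+t)^{δ}. In other words, for the Rosenau kernel (with ε = σ = 1) the homogeneous Sobolev norm ‖Ĝ_ε(ξ/√(1+t), t)‖_{Ḣ^s} of the rescaled regular part e^{−t}(e^{t M̂(ξ)} − 1), with M̂(ξ) = 1/(1+ξ²), grows slower than any positive power of (1+t). -/

import Mathlib

open MeasureTheory Filter

lemma rosenau_aux (t ξ : ℝ) (ht : 0 ≤ t) :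
    0 ≤ Real.exp (t / (1 + ξ ^ 2 / (1 + t))) - 1 ∧
    (1 + ξ ^ 2) * (Real.exp (t / (1 + ξ ^ 2 / (1 + t))) - 1) ≤ 5 * Real.exp t := by
  have h1 : 0 < 1 + t := by linarith
  obtain ⟨x, hx⟩ : ∃ x, x = ξ ^ 2 / (1 + t) := ⟨_, rfl⟩
  have hx0 : 0 ≤ x := by rw [hx]; positivity
  have hξ : ξ ^ 2 = (1 + t) * x := by rw [hx]; field_simp
  rw [← hx, hξ]
  obtain ⟨a, ha⟩ : ∃ a, a = t / (1 + x) := ⟨_, rfl⟩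
  have ha0 : 0 ≤ a := by rw [ha]; positivity
  have hta : t = a + a * x := by rw [ha]; field_simp
  rw [← ha]
  have hy0 : 0 ≤ a * x := by positivity
  have hE := Real.quadratic_le_exp_of_nonneg hy0
  have hA : 0 ≤ Real.exp a - 1 := by linarith [Real.one_le_exp ha0]
  refine ⟨hA, ?_⟩
  have hB : Real.exp a - 1 ≤ a * Real.exp a := by
    have h2 := Real.add_one_le_exp (-a)
    have h3 : Real.exp (-a) * Real.exp a = 1 := by rw [← Real.exp_add]; simp
    nlinarith [Real.exp_pos a]
  have hP := Real.exp_pos a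
  have e1 : Real.exp t = Real.exp a * Real.exp (a * x) := by rw [← Real.exp_add, ← hta]
  rw [e1]
  have e2 : (1 + (1 + t) * x) * (Real.exp a - 1)
      = (1 + a * x) * (Real.exp a - 1) + (x + a * x * x) * (Real.exp a - 1) := by
    rw [hta]; ring
  rw [e2]
  have k1 : (1 + a * x) * (Real.exp a - 1) ≤ (1 + a * x) * Real.exp a :=
    mul_le_mul_of_nonneg_left (by linarith) (by positivity)
  have k2 : (x + a * x * x) * (Real.exp a - 1) ≤ (x + a * x * x) * (a * Real.exp a) :=
    mul_le_mul_of_nonneg_left hB (by positivity)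
  have k3 : Real.exp a * (1 + a * x + (a * x) + (a * x) ^ 2)
      ≤ Real.exp a * (5 * Real.exp (a * x)) :=
    mul_le_mul_of_nonneg_left (by nlinarith [sq_nonneg (a * x)]) hP.le
  nlinarith

theorem rosenau_regular_part_sobolev_growth
    (s δ : ℝ) (hs0 : 0 < s) (hs1 : s < 1) (hδ : 0 < δ) :
    ∃ C : ℝ, ∀ t : ℝ, 0 ≤ t →
      Real.exp (-t) *
          (∫ ξ : ℝ, |ξ| ^ (2 * s) * (Real.exp (t / (1 + ξ ^ 2 / (1 + t))) - 1) ^ 2)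
            ^ ((1 : ℝ) / 2)
        ≤ C * (1 + t) ^ δ := by
  obtain ⟨J, hJ⟩ : ∃ J : ℝ, J = ∫ ξ : ℝ, 25 * (1 + ξ ^ 2)⁻¹ := ⟨_, rfl⟩
  refine ⟨Real.sqrt J, fun t ht => ?_⟩
  rw [← Real.sqrt_eq_rpow]
  have hI : (∫ ξ : ℝ, |ξ| ^ (2 * s) * (Real.exp (t / (1 + ξ ^ 2 / (1 + t))) - 1) ^ 2)
      ≤ Real.exp t ^ 2 * J := by
    rw [hJ, ← integral_const_mul]
    refine integral_mono_of_nonneg (Eventually.of_forall fun ξ => by positivity)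
      ((integrable_inv_one_add_sq.const_mul _).const_mul _)
      (Eventually.of_forall fun ξ => ?_)
    obtain ⟨h0, h5⟩ := rosenau_aux t ξ ht
    dsimp only
    generalize Real.exp (t / (1 + ξ ^ 2 / (1 + t))) - 1 = F at *
    have hq : 0 < 1 + ξ ^ 2 := by positivity
    have hw : |ξ| ^ (2 * s) ≤ 1 + ξ ^ 2 := by
      rw [Real.rpow_mul (abs_nonneg _), Real.rpow_two, sq_abs]
      calc (ξ ^ 2) ^ s ≤ (1 + ξ ^ 2) ^ s :=
            Real.rpow_le_rpow (by positivity) (by linarith) hs0.le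
        _ ≤ (1 + ξ ^ 2) ^ (1 : ℝ) :=
            Real.rpow_le_rpow_of_exponent_le (by nlinarith [sq_nonneg ξ]) hs1.le
        _ = _ := Real.rpow_one _
    have h6 : ((1 + ξ ^ 2) * F) ^ 2 ≤ (5 * Real.exp t) ^ 2 :=
      pow_le_pow_left₀ (by positivity) h5 2
    calc |ξ| ^ (2 * s) * F ^ 2 ≤ (1 + ξ ^ 2) * F ^ 2 :=
          mul_le_mul_of_nonneg_right hw (by positivity)
      _ = ((1 + ξ ^ 2) * F) ^ 2 * (1 + ξ ^ 2)⁻¹ := by field_simp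
      _ ≤ (5 * Real.exp t) ^ 2 * (1 + ξ ^ 2)⁻¹ :=
          mul_le_mul_of_nonneg_right h6 (by positivity)
      _ = _ := by ring
  have h2 := Real.sqrt_le_sqrt hI
  rw [Real.sqrt_mul (by positivity), Real.sqrt_sq (Real.exp_pos t).le] at h2
  have h3 : (1 : ℝ) ≤ (1 + t) ^ δ := Real.one_le_rpow (by linarith) hδ.le
  calc _ ≤ Real.exp (-t) * (Real.exp t * Real.sqrt J) :=
        mul_le_mul_of_nonneg_left h2 (Real.exp_pos _).le
    _ = Real.sqrt J := by rw [← mul_assoc, ← Real.exp_add]; simp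
    _ ≤ _ := le_mul_of_one_le_right (Real.sqrt_nonneg _) h3
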